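/- arXiv:2409.06877 — 7 statements merged into one kernel-verified Lean document; each statement's English description precedes it below -/
import Mathlib

section
/- Let a dynamically nontrivial (n,m,r) mass action network factor over a p-partition P, and fix admissible choices of h, W, Q̂, Ĝ as in the context. Then for every κ ∈ ℝ^m_+ the map F_κ(α,μ) := (h(α)/κ)^Ĝ ∘ μ^Q̂ is smooth on Y × ℝ^{n−s_P}_+ and injective on A_κ × ℝ^{n−s_P}_+, and the positive equilibrium set satisfies E_κ = F_κ(A_κ × ℝ^{n−s_P}_+) = {(h(α)/κ)^Ĝ ∘ μ^Q̂ : α ∈ A_κ, μ ∈ ℝ^{n−s_P}_+}. -/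
open Matrix

noncomputable section

/-- Entrywise power of a vector by a real exponent matrix:
`(powVec M x) i = ∏ j, (x j) ^ (M i j)` (real powers). -/
def powVec {k l : ℕ} (M : Matrix (Fin k) (Fin l) ℝ) (x : Fin l → ℝ) : Fin k → ℝ :=
  fun i => ∏ j, x j ^ M i j

/-- Cast an integer matrix to a real matrix. -/
def mR {a b : ℕ} (M : Matrix (Fin a) (Fin b) ℤ) : Matrix (Fin a) (Fin b) ℝ :=
  M.map fun t => (t : ℝ)

/-- The (open) positive orthant. -/
def posOrth (k : ℕ) : Set (Fin k → ℝ) :=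
  {x | ∀ i, 0 < x i}

/-- The mass action vector field `g_κ(x) = Γ (κ ∘ x^A)`. -/
def massAction {n m : ℕ} (Γ : Matrix (Fin n) (Fin m) ℤ) (A : Matrix (Fin m) (Fin n) ℤ)
    (κ : Fin m → ℝ) (x : Fin n → ℝ) : Fin n → ℝ :=
  (mR Γ).mulVec (κ * powVec (mR A) x)

/-- The positive equilibrium set `E_κ`. -/
def Eset {n m : ℕ} (Γ : Matrix (Fin n) (Fin m) ℤ) (A : Matrix (Fin m) (Fin n) ℤ)
    (κ : Fin m → ℝ) : Set (Fin n → ℝ) :=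
  {x | (∀ i, 0 < x i) ∧ massAction Γ A κ x = 0}

/-- The Jacobian matrix `Γ D_{κ∘x^A} A D_{1/x}` of `g_κ` at `x`. -/
def jacMat {n m : ℕ} (Γ : Matrix (Fin n) (Fin m) ℤ) (A : Matrix (Fin m) (Fin n) ℤ)
    (κ : Fin m → ℝ) (x : Fin n → ℝ) : Matrix (Fin n) (Fin n) ℝ :=
  mR Γ * Matrix.diagonal (κ * powVec (mR A) x) * mR A * Matrix.diagonal (fun i => (x i)⁻¹)

/-- Nondegeneracy of an equilibrium: `ker J_{g_κ}(x) ∩ im Γ = {0}`. -/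
def nondegAt {n m : ℕ} (Γ : Matrix (Fin n) (Fin m) ℤ) (A : Matrix (Fin m) (Fin n) ℤ)
    (κ : Fin m → ℝ) (x : Fin n → ℝ) : Prop :=
  ∀ z : Fin n → ℝ, (jacMat Γ A κ x).mulVec z = 0 → (∃ v, (mR Γ).mulVec v = z) → z = 0

/-- Strong degeneracy of the network: every positive equilibrium has Jacobian of
rank less than `rank Γ`, for every choice of rate constants. -/
def stronglyDegenerate {n m : ℕ} (Γ : Matrix (Fin n) (Fin m) ℤ)
    (A : Matrix (Fin m) (Fin n) ℤ) : Prop :=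
  ∀ κ ∈ posOrth m, ∀ x ∈ Eset Γ A κ, (jacMat Γ A κ x).rank < (mR Γ).rank

/-- Dynamically nontrivial: the positive flux cone `ker Γ ∩ ℝ^m_+` is nonempty. -/
def dynNontrivial {n m : ℕ} (Γ : Matrix (Fin n) (Fin m) ℤ) : Prop :=
  ∃ v : Fin m → ℝ, (mR Γ).mulVec v = 0 ∧ ∀ j, 0 < v j

/-- `ker Γ` factors over the partition of `{1,…,m}` given by the fibres of `blk`. -/
def factorsOver {n m p : ℕ} (Γ : Matrix (Fin n) (Fin m) ℤ) (blk : Fin m → Fin p) : Prop :=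
  ∀ v : Fin m → ℝ, (mR Γ).mulVec v = 0 →
    ∀ i : Fin p, (mR Γ).mulVec (fun j => if blk j = i then v j else 0) = 0

/-- The matrix `[A | 1_P]`. -/
def srcMat {n m p : ℕ} (A : Matrix (Fin m) (Fin n) ℤ) (blk : Fin m → Fin p) :
    Matrix (Fin m) (Fin (n + p)) ℝ :=
  Matrix.of fun j => Fin.append (fun k => (A j k : ℝ)) (fun i => if blk j = i then 1 else 0)

/-- The first `n` rows of an `(n+p)×k` matrix. -/
def topRows (n p : ℕ) {k : ℕ} (M : Matrix (Fin (n + p)) (Fin k) ℝ) :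
    Matrix (Fin n) (Fin k) ℝ :=
  Matrix.of fun i j => M (Fin.castAdd p i) j

/-- The flux-cone parameterisation `(1_P λ) ∘ h(α)`. -/
def fluxParam {m p d : ℕ} (blk : Fin m → Fin p) (h : (Fin d → ℝ) → (Fin m → ℝ))
    (lam : Fin p → ℝ) (α : Fin d → ℝ) : Fin m → ℝ :=
  fun j => lam (blk j) * h α j

/-- Admissible cross-section parameterisation of the positive flux cone:
`Y` is an open bounded convex set (an open polytope), `h` is affine and injective,
depends blockwise on the coordinates of `Y`, and `(λ, α) ↦ (1_P λ) ∘ h(α)` is a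
bijection from `ℝ^p_+ × Y` onto the positive flux cone. -/
def admissibleH {n m p d : ℕ} (Γ : Matrix (Fin n) (Fin m) ℤ) (blk : Fin m → Fin p)
    (Y : Set (Fin d → ℝ)) (h : (Fin d → ℝ) → (Fin m → ℝ)) : Prop :=
  IsOpen Y ∧ Convex ℝ Y ∧ Bornology.IsBounded Y ∧ Y.Nonempty ∧
  (∃ (L : (Fin d → ℝ) →ₗ[ℝ] (Fin m → ℝ)) (c : Fin m → ℝ), ∀ α, h α = L α + c) ∧
  (∃ bY : Fin d → Fin p, ∀ (α α' : Fin d → ℝ) (j : Fin m),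
      (∀ t, bY t = blk j → α t = α' t) → h α j = h α' j) ∧
  (∀ (lam : Fin p → ℝ) (α : Fin d → ℝ), (∀ i, 0 < lam i) → α ∈ Y →
      (mR Γ).mulVec (fluxParam blk h lam α) = 0 ∧ ∀ j, 0 < fluxParam blk h lam α j) ∧
  (∀ v : Fin m → ℝ, (mR Γ).mulVec v = 0 → (∀ j, 0 < v j) →
      ∃ (lam : Fin p → ℝ) (α : Fin d → ℝ), (∀ i, 0 < lam i) ∧ α ∈ Y ∧
        v = fluxParam blk h lam α) ∧
  (∀ (lam lam' : Fin p → ℝ) (α α' : Fin d → ℝ), (∀ i, 0 < lam i) → (∀ i, 0 < lam' i) →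
      α ∈ Y → α' ∈ Y → fluxParam blk h lam α = fluxParam blk h lam' α' →
      lam = lam' ∧ α = α')

/-- The solvability variety `A_κ = {α ∈ Y : h(α)^W = κ^W}`. -/
def Aset {m d w : ℕ} (W : Matrix (Fin w) (Fin m) ℝ) (Y : Set (Fin d → ℝ))
    (h : (Fin d → ℝ) → (Fin m → ℝ)) (κ : Fin m → ℝ) : Set (Fin d → ℝ) :=
  {α ∈ Y | powVec W (h α) = powVec W κ}

/-- The rows of `W` form a basis of `ker [A|1_P]ᵀ`. -/
def isSolvabilityMatrix {n m p w : ℕ} (A : Matrix (Fin m) (Fin n) ℤ) (blk : Fin m → Fin p)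
    (W : Matrix (Fin w) (Fin m) ℝ) : Prop :=
  W * srcMat A blk = 0 ∧ W.rank = w ∧ w + (srcMat A blk).rank = m

/-- The columns of `Q` form a basis of `ker [A|1_P]`. -/
def isKernelMatrix {n m p q : ℕ} (A : Matrix (Fin m) (Fin n) ℤ) (blk : Fin m → Fin p)
    (Q : Matrix (Fin (n + p)) (Fin q) ℝ) : Prop :=
  srcMat A blk * Q = 0 ∧ Q.rank = q ∧ (srcMat A blk).rank + q = n + p

/-- `G` is a generalised inverse of `[A|1_P]`. -/
def isGenInv {n m p : ℕ} (A : Matrix (Fin m) (Fin n) ℤ) (blk : Fin m → Fin p)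
    (G : Matrix (Fin (n + p)) (Fin m) ℝ) : Prop :=
  srcMat A blk * G * srcMat A blk = srcMat A blk

/-- The parameterising map `F_κ(α,μ) = (h(α)/κ)^Ĝ ∘ μ^Q̂`. -/
def Fmap {n m p d q : ℕ} (G : Matrix (Fin (n + p)) (Fin m) ℝ)
    (Q : Matrix (Fin (n + p)) (Fin q) ℝ)
    (h : (Fin d → ℝ) → (Fin m → ℝ)) (κ : Fin m → ℝ) :
    (Fin d → ℝ) × (Fin q → ℝ) → (Fin n → ℝ) :=
  fun z => powVec (topRows n p G) (h z.1 / κ) * powVec (topRows n p Q) z.2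


theorem powVec_eq_exp {k l : ℕ} (M : Matrix (Fin k) (Fin l) ℝ) (x : Fin l → ℝ)
    (hx : ∀ j, 0 < x j) (i : Fin k) :
    powVec M x i = Real.exp (M.mulVec (fun j => Real.log (x j)) i) := by
  simp only [powVec, Matrix.mulVec, dotProduct, Real.exp_sum]
  refine Finset.prod_congr rfl fun j _ => ?_
  rw [Real.rpow_def_of_pos (hx j), mul_comm]

theorem srcMat_mulVec {n m p : ℕ} (A : Matrix (Fin m) (Fin n) ℤ) (blk : Fin m → Fin p)
    (z : Fin (n + p) → ℝ) (j : Fin m) :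
    (srcMat A blk).mulVec z j =
      (mR A).mulVec (fun k => z (Fin.castAdd p k)) j + z (Fin.natAdd n (blk j)) := by
  simp [srcMat, Matrix.mulVec, dotProduct, Fin.sum_univ_add, mR]

theorem exists_of_exact {a b c : ℕ} (M : Matrix (Fin b) (Fin c) ℝ) (W : Matrix (Fin a) (Fin b) ℝ)
    (h0 : W * M = 0) (hr : W.rank + M.rank = b) (v : Fin b → ℝ) (hv : W.mulVec v = 0) :
    ∃ u, M.mulVec u = v := by
  have hle : LinearMap.range M.mulVecLin ≤ LinearMap.ker W.mulVecLin := by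
    rintro _ ⟨u, rfl⟩
    simp [h0]
  have hrn := LinearMap.finrank_range_add_finrank_ker W.mulVecLin
  have heq := Submodule.eq_of_le_of_finrank_eq hle (by
    simp only [Module.finrank_fin_fun] at hrn
    simp only [Matrix.rank] at hr
    omega)
  have : v ∈ LinearMap.range M.mulVecLin := by
    rw [heq]; simpa using hv
  obtain ⟨u, hu⟩ := this
  exact ⟨u, by simpa using hu⟩

theorem inj_of_rank {a b : ℕ} (Q : Matrix (Fin a) (Fin b) ℝ) (hr : Q.rank = b) :
    Function.Injective Q.mulVec := by
  have hrn := LinearMap.finrank_range_add_finrank_ker Q.mulVecLin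
  simp only [Module.finrank_fin_fun] at hrn
  simp only [Matrix.rank] at hr
  have h0 : Module.finrank ℝ (LinearMap.ker Q.mulVecLin) = 0 := by omega
  have := LinearMap.ker_eq_bot.1 (Submodule.finrank_eq_zero.1 h0)
  intro x y hxy
  exact this (by simpa using hxy)

theorem key_iff {n m p d : ℕ} (A : Matrix (Fin m) (Fin n) ℤ) (blk : Fin m → Fin p)
    (h : (Fin d → ℝ) → (Fin m → ℝ)) (κ : Fin m → ℝ) (hκ : ∀ j, 0 < κ j) (α : Fin d → ℝ)
    (hh : ∀ j, 0 < h α j) (z : Fin (n + p) → ℝ) :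
    (srcMat A blk).mulVec z = (fun j => Real.log ((h α / κ) j)) ↔
      κ * powVec (mR A) (fun k => Real.exp (z (Fin.castAdd p k))) =
        fluxParam blk h (fun i => Real.exp (- z (Fin.natAdd n i))) α := by
  rw [funext_iff, funext_iff]
  refine forall_congr' fun j => ?_
  rw [srcMat_mulVec, Pi.mul_apply, powVec_eq_exp _ _ (fun k => Real.exp_pos _)]
  simp only [Real.log_exp, fluxParam, Pi.div_apply]
  generalize (mR A).mulVec (fun k => z (Fin.castAdd p k)) j = s
  generalize z (Fin.natAdd n (blk j)) = t
  have hk := hκ j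
  have hj := hh j
  rw [Real.log_div hj.ne' hk.ne']
  rw [← Real.log_injOn_pos.eq_iff (x := κ j * Real.exp s) (y := Real.exp (-t) * h α j)
    (Set.mem_Ioi.2 (by positivity)) (Set.mem_Ioi.2 (by positivity)),
    Real.log_mul hk.ne' (Real.exp_pos _).ne', Real.log_mul (Real.exp_pos _).ne' hj.ne',
    Real.log_exp, Real.log_exp]
  constructor <;> intro H <;> linarith

/-- Logarithmic form of `F_κ`, before taking the first `n` coordinates. -/
def zvec {n m p d q : ℕ} (G : Matrix (Fin (n + p)) (Fin m) ℝ)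
    (Q : Matrix (Fin (n + p)) (Fin q) ℝ)
    (h : (Fin d → ℝ) → (Fin m → ℝ)) (κ : Fin m → ℝ) (α : Fin d → ℝ) (μ : Fin q → ℝ) :
    Fin (n + p) → ℝ :=
  G.mulVec (fun j => Real.log ((h α / κ) j)) + Q.mulVec (fun j => Real.log (μ j))

theorem Fmap_eq_exp {n m p d q : ℕ} (G : Matrix (Fin (n + p)) (Fin m) ℝ)
    (Q : Matrix (Fin (n + p)) (Fin q) ℝ)
    (h : (Fin d → ℝ) → (Fin m → ℝ)) (κ : Fin m → ℝ) (hκ : ∀ j, 0 < κ j) (α : Fin d → ℝ)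
    (hh : ∀ j, 0 < h α j) (μ : Fin q → ℝ) (hμ : ∀ j, 0 < μ j) :
    Fmap G Q h κ (α, μ) = fun k => Real.exp (zvec G Q h κ α μ (Fin.castAdd p k)) := by
  funext k
  simp only [Fmap, Pi.mul_apply]
  rw [powVec_eq_exp _ (h α / κ) (fun j => div_pos (hh j) (hκ j)), powVec_eq_exp _ _ hμ, ← Real.exp_add]
  rfl

theorem powVec_eq_iff {w m : ℕ} (W : Matrix (Fin w) (Fin m) ℝ) (x y : Fin m → ℝ)
    (hx : ∀ j, 0 < x j) (hy : ∀ j, 0 < y j) :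
    powVec W x = powVec W y ↔ W.mulVec (fun j => Real.log ((x / y) j)) = 0 := by
  have : (fun j => Real.log ((x / y) j)) =
      (fun j => Real.log (x j)) - (fun j => Real.log (y j)) := by
    funext j
    simp [Real.log_div (hx j).ne' (hy j).ne']
  rw [this, Matrix.mulVec_sub, sub_eq_zero, funext_iff, funext_iff]
  refine forall_congr' fun i => ?_
  rw [powVec_eq_exp _ _ hx, powVec_eq_exp _ _ hy, Real.exp_eq_exp]

/-- Theorem `thminj`(i): for a dynamically nontrivial `(n,m,r)` network
factoring over a `p`-partition, and any admissible choices of `h`, `W`, `Q`, `G`,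
the map `F_κ` is smooth on `Y × ℝ^{n-s_P}_+`, injective on `A_κ × ℝ^{n-s_P}_+`, and
`E_κ = F_κ(A_κ × ℝ^{n-s_P}_+)`. -/
theorem statement0 {n m p d w q : ℕ}
    (Γ : Matrix (Fin n) (Fin m) ℤ) (A : Matrix (Fin m) (Fin n) ℤ)
    (hA : ∀ i j, 0 ≤ A i j)
    (blk : Fin m → Fin p) (hblk : Function.Surjective blk)
    (hdyn : dynNontrivial Γ) (hfac : factorsOver Γ blk)
    (Y : Set (Fin d → ℝ)) (h : (Fin d → ℝ) → (Fin m → ℝ))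
    (hd : m = d + (mR Γ).rank + p)
    (hadm : admissibleH Γ blk Y h)
    (W : Matrix (Fin w) (Fin m) ℝ) (hW : isSolvabilityMatrix A blk W)
    (Q : Matrix (Fin (n + p)) (Fin q) ℝ) (hQ : isKernelMatrix A blk Q)
    (G : Matrix (Fin (n + p)) (Fin m) ℝ) (hG : isGenInv A blk G)
    (κ : Fin m → ℝ) (hκ : κ ∈ posOrth m) :
    ContDiffOn ℝ (⊤ : ℕ∞) (Fmap G Q h κ) (Y ×ˢ posOrth q) ∧
    Set.InjOn (Fmap G Q h κ) (Aset W Y h κ ×ˢ posOrth q) ∧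
    Eset Γ A κ = Fmap G Q h κ '' (Aset W Y h κ ×ˢ posOrth q) := by
  obtain ⟨hYo, -, -, -, ⟨L, c, hL⟩, -, hf1, hf2, hf3⟩ := hadm
  obtain ⟨hW0, hWr, hWd⟩ := hW
  obtain ⟨hQ0, hQr, hQd⟩ := hQ
  have hκ' : ∀ j, 0 < κ j := hκ
  have hpos : ∀ α ∈ Y, ∀ j, 0 < h α j := fun α hα j => by
    simpa [fluxParam] using (hf1 (fun _ => 1) α (fun _ => one_pos) hα).2 j
  have hz : ∀ α ∈ Aset W Y h κ, ∀ μ : Fin q → ℝ,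
      (srcMat A blk).mulVec (zvec G Q h κ α μ) = fun j => Real.log ((h α / κ) j) := by
    rintro α ⟨hαY, hα⟩ μ
    rw [powVec_eq_iff _ _ _ (hpos α hαY) hκ'] at hα
    obtain ⟨u, hu⟩ := exists_of_exact (srcMat A blk) W hW0 (by omega) _ hα
    rw [zvec, Matrix.mulVec_add, Matrix.mulVec_mulVec, Matrix.mulVec_mulVec, hQ0,
      Matrix.zero_mulVec, add_zero, ← hu, Matrix.mulVec_mulVec, hG]
  refine ⟨?_, ?_, ?_⟩
  · have hcd : ContDiff ℝ (⊤ : ℕ∞) h := by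
      have : h = fun α => L.toContinuousLinearMap α + c := funext fun α => by simp [hL]
      rw [this]
      fun_prop
    rw [contDiffOn_pi]
    intro k
    simp only [Fmap, Pi.mul_apply, powVec]
    refine ContDiffOn.mul ?_ ?_
    · refine contDiffOn_prod fun j _ => ?_
      refine ContDiffOn.rpow_const_of_ne ?_ ?_
      · have h1 : ContDiff ℝ (⊤ : ℕ∞) (fun z : (Fin d → ℝ) × (Fin q → ℝ) => h z.1 j) :=
          (contDiff_pi.1 hcd j).comp contDiff_fst
        exact (h1.div_const (κ j)).contDiffOn
      · rintro ⟨α, μ⟩ ⟨hα, -⟩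
        exact (div_pos (hpos α hα j) (hκ' j)).ne'
    · refine contDiffOn_prod fun j _ => ?_
      refine ContDiffOn.rpow_const_of_ne ?_ ?_
      · exact ((contDiff_pi.1 contDiff_snd j)).contDiffOn
      · rintro ⟨α, μ⟩ ⟨-, hμ⟩
        exact (hμ j).ne'
  · rintro ⟨α, μ⟩ ⟨hα, hμ⟩ ⟨α', μ'⟩ ⟨hα', hμ'⟩ heq
    simp only at hα hμ hα' hμ'
    have hαY := hα.1
    have hαY' := hα'.1
    rw [Fmap_eq_exp _ _ _ _ hκ' _ (hpos α hαY) _ hμ,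
      Fmap_eq_exp _ _ _ _ hκ' _ (hpos α' hαY') _ hμ'] at heq
    have e1 := (key_iff A blk h κ hκ' α (hpos α hαY) _).1 (hz α hα μ)
    have e2 := (key_iff A blk h κ hκ' α' (hpos α' hαY') _).1 (hz α' hα' μ')
    rw [heq] at e1
    obtain ⟨h1, h2⟩ := hf3 _ _ α α' (fun i => Real.exp_pos _) (fun i => Real.exp_pos _)
      hαY hαY' (e1.symm.trans e2)
    subst h2
    have hzz : zvec G Q h κ α μ = zvec G Q h κ α μ' := by
      funext i
      refine Fin.addCases (fun k => ?_) (fun k => ?_) i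
      · exact Real.exp_injective (congrFun heq k)
      · exact neg_injective (Real.exp_injective (congrFun h1 k))
    have hl := inj_of_rank Q hQr (add_left_cancel hzz)
    have : μ = μ' := funext fun j =>
      Real.log_injOn_pos (Set.mem_Ioi.2 (hμ j)) (Set.mem_Ioi.2 (hμ' j)) (congrFun hl j)
    rw [this]
  · ext x
    constructor
    · rintro ⟨hx, hx0⟩
      obtain ⟨lam, α, hlam, hαY, hv⟩ := hf2 _ hx0 (fun j => by
        rw [Pi.mul_apply, powVec_eq_exp _ _ hx]
        exact mul_pos (hκ' j) (Real.exp_pos _))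
      set z : Fin (n + p) → ℝ :=
        Fin.append (fun k => Real.log (x k)) (fun i => - Real.log (lam i)) with hzdef
      have hxz : (fun k => Real.exp (z (Fin.castAdd p k))) = x := by
        funext k
        simp [hzdef, Real.exp_log (hx k)]
      have hlz : (fun i => Real.exp (- z (Fin.natAdd n i))) = lam := by
        funext i
        simp [hzdef, Real.exp_log (hlam i)]
      have hMz := (key_iff A blk h κ hκ' α (hpos α hαY) z).2 (by rw [hxz, hlz]; exact hv)
      have hαA : α ∈ Aset W Y h κ := by
        refine ⟨hαY, ?_⟩
        rw [powVec_eq_iff _ _ _ (hpos α hαY) hκ', ← hMz, Matrix.mulVec_mulVec, hW0,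
          Matrix.zero_mulVec]
      have hker : (srcMat A blk).mulVec
          (z - G.mulVec (fun j => Real.log ((h α / κ) j))) = 0 := by
        rw [← hMz, Matrix.mulVec_sub, Matrix.mulVec_mulVec, Matrix.mulVec_mulVec, hG, sub_self]
      obtain ⟨ν, hν⟩ := exists_of_exact Q (srcMat A blk) hQ0 (by omega) _ hker
      refine ⟨(α, fun j => Real.exp (ν j)), ⟨hαA, fun j => Real.exp_pos _⟩, ?_⟩
      rw [Fmap_eq_exp _ _ _ _ hκ' _ (hpos α hαY) _ (fun j => Real.exp_pos _)]
      have : zvec G Q h κ α (fun j => Real.exp (ν j)) = z := by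
        simp only [zvec, Real.log_exp]
        rw [hν]
        abel
      rw [this, hxz]
    · rintro ⟨⟨α, μ⟩, ⟨hα, hμ⟩, rfl⟩
      simp only at hα hμ
      rw [Fmap_eq_exp _ _ _ _ hκ' _ (hpos α hα.1) _ hμ]
      refine ⟨fun i => Real.exp_pos _, ?_⟩
      rw [massAction, (key_iff A blk h κ hκ' α (hpos α hα.1) _).1 (hz α hα μ)]
      exact (hf1 _ α (fun i => Real.exp_pos _) hα.1).1

end
end

section
/- Let a dynamically nontrivial (n,m,r) mass action network factor over a p-partition P, with admissible choices of h, W, Q̂, Ĝ as in the context, and let T_κ(α,μ) := h(α)^W − κ^W and F_κ(α,μ) := (h(α)/κ)^Ĝ ∘ μ^Q̂. Fix κ ∈ ℝ^m_+ and (α,μ) ∈ A_κ × ℝ^{n−s_P}_+, and set x := F_κ(α,μ) ∈ E_κ. Then the Jacobian J_{F_κ}(α,μ) maps ker J_{T_κ}(α,μ) isomorphically onto ker J_{g_κ}(x); in particular ker J_{T_κ}(α,μ) ≅ ker J_{g_κ}(x). -/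
open Matrix

noncomputable section

lemma aux_powVec_pos {k l : ℕ} (M : Matrix (Fin k) (Fin l) ℝ) (x : Fin l → ℝ)
    (hx : ∀ j, 0 < x j) (i : Fin k) : 0 < powVec M x i :=
  Finset.prod_pos fun j _ => Real.rpow_pos_of_pos (hx j) _

lemma aux_powVec_exp {k l : ℕ} (M : Matrix (Fin k) (Fin l) ℝ) (x : Fin l → ℝ)
    (hx : ∀ j, 0 < x j) (i : Fin k) :
    powVec M x i = Real.exp (∑ j, M i j * Real.log (x j)) := by
  rw [Real.exp_sum]
  refine Finset.prod_congr rfl fun j _ => ?_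
  rw [Real.rpow_def_of_pos (hx j), mul_comm]

lemma aux_log_powVec {k l : ℕ} (M : Matrix (Fin k) (Fin l) ℝ) (x : Fin l → ℝ)
    (hx : ∀ j, 0 < x j) (i : Fin k) :
    Real.log (powVec M x i) = (M.mulVec fun j => Real.log (x j)) i := by
  rw [aux_powVec_exp M x hx, Real.log_exp]; rfl

lemma aux_hasFDeriv {k l : ℕ} (M : Matrix (Fin k) (Fin l) ℝ) (x : Fin l → ℝ)
    (hx : ∀ j, 0 < x j) :
    ∃ D : (Fin l → ℝ) →L[ℝ] (Fin k → ℝ), HasFDerivAt (powVec M) D x ∧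
      ∀ v, D v = powVec M x * M.mulVec (v / x) := by
  have key : ∀ i : Fin k, HasFDerivAt (fun y : Fin l → ℝ => powVec M y i)
      (powVec M x i • ∑ j, M i j • ((x j)⁻¹ • (ContinuousLinearMap.proj j :
        (Fin l → ℝ) →L[ℝ] ℝ))) x := by
    intro i
    have h1 : HasFDerivAt (fun y : Fin l → ℝ => Real.exp (∑ j, M i j * Real.log (y j)))
      (Real.exp (∑ j, M i j * Real.log (x j)) • ∑ j, M i j • ((x j)⁻¹ •
        (ContinuousLinearMap.proj j : (Fin l → ℝ) →L[ℝ] ℝ))) x := by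
      apply HasFDerivAt.exp
      apply HasFDerivAt.fun_sum
      intro j _
      apply HasFDerivAt.const_mul
      exact HasFDerivAt.log (hasFDerivAt_apply j x) (hx j).ne'
    rw [← aux_powVec_exp M x hx i] at h1
    refine h1.congr_of_eventuallyEq ?_
    have : ∀ᶠ y in nhds x, ∀ j, 0 < y j := by
      rw [Filter.eventually_all]
      intro j
      exact (continuous_apply j).continuousAt.eventually (lt_mem_nhds (hx j))
    filter_upwards [this] with y hy
    exact aux_powVec_exp M y hy i
  refine ⟨_, hasFDerivAt_pi.2 key, ?_⟩
  intro v
  ext i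
  simp [Matrix.mulVec, dotProduct, div_eq_inv_mul]

lemma aux_inj {k l : ℕ} (Q : Matrix (Fin k) (Fin l) ℝ) (hr : Q.rank = l) (σ : Fin l → ℝ)
    (h : Q.mulVec σ = 0) : σ = 0 := by
  have h1 := LinearMap.finrank_range_add_finrank_ker Q.mulVecLin
  have h2 : Module.finrank ℝ (LinearMap.range Q.mulVecLin) = l := hr
  rw [h2] at h1
  have h3 : Module.finrank ℝ (LinearMap.ker Q.mulVecLin) = 0 := by simpa using h1
  have h4 := Submodule.finrank_eq_zero.1 h3
  have : σ ∈ LinearMap.ker Q.mulVecLin := by simpa using h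
  rw [h4] at this
  simpa using this

lemma aux_exact {a b c : ℕ} (M : Matrix (Fin a) (Fin b) ℝ) (N : Matrix (Fin b) (Fin c) ℝ)
    (h0 : M * N = 0) (hr : M.rank + N.rank = b) (z : Fin b → ℝ) (hz : M.mulVec z = 0) :
    ∃ y, z = N.mulVec y := by
  have hle : LinearMap.range N.mulVecLin ≤ LinearMap.ker M.mulVecLin := by
    rintro _ ⟨y, rfl⟩
    simp [Matrix.mulVec_mulVec, h0]
  have h1 := LinearMap.finrank_range_add_finrank_ker M.mulVecLin
  have e1 : Module.finrank ℝ (LinearMap.range M.mulVecLin) = M.rank := rfl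
  have e2 : Module.finrank ℝ (LinearMap.range N.mulVecLin) = N.rank := rfl
  have e3 : Module.finrank ℝ (Fin b → ℝ) = b := by simp
  have heq := Submodule.eq_of_le_of_finrank_eq hle (by omega)
  have : z ∈ LinearMap.ker M.mulVecLin := by simpa using hz
  rw [← heq] at this
  obtain ⟨y, hy⟩ := this
  exact ⟨y, hy.symm⟩

lemma aux_src {n m p : ℕ} (A : Matrix (Fin m) (Fin n) ℤ) (blk : Fin m → Fin p)
    (y : Fin (n + p) → ℝ) (j : Fin m) :
    (srcMat A blk).mulVec y j =
      (mR A).mulVec (fun i => y (Fin.castAdd p i)) j + y (Fin.natAdd n (blk j)) := by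
  simp [Matrix.mulVec, dotProduct, Fin.sum_univ_add, srcMat, mR]

lemma aux_scale {n m p : ℕ} (Γ : Matrix (Fin n) (Fin m) ℤ) (blk : Fin m → Fin p)
    (hfac : factorsOver Γ blk) (v : Fin m → ℝ) (hv : (mR Γ).mulVec v = 0) (lam : Fin p → ℝ) :
    (mR Γ).mulVec (fun j => lam (blk j) * v j) = 0 := by
  have : (fun j => lam (blk j) * v j) =
      ∑ i, lam i • (fun j => if blk j = i then v j else 0) := by
    ext j
    simp [Finset.sum_apply]
  rw [this, Matrix.mulVec_sum]
  refine Finset.sum_eq_zero fun i _ => ?_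
  rw [Matrix.mulVec_smul, hfac v hv i, smul_zero]

lemma aux_small {m : ℕ} (H v : Fin m → ℝ) (hH : ∀ j, 0 < H j) :
    ∀ᶠ ε in nhds (0 : ℝ), ∀ j, 0 < H j + ε * v j := by
  rw [Filter.eventually_all]
  intro j
  have : Continuous fun ε : ℝ => H j + ε * v j := by fun_prop
  exact this.continuousAt.eventually (lt_mem_nhds (by simpa using hH j))

lemma aux_pick {P : ℝ → Prop} (h : ∀ᶠ ε in nhds (0 : ℝ), P ε) : ∃ ε, 0 < ε ∧ P ε := by
  have h1 : ∀ᶠ ε in nhdsWithin (0 : ℝ) (Set.Ioi 0), P ε := h.filter_mono nhdsWithin_le_nhds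
  have h2 : ∀ᶠ ε in nhdsWithin (0 : ℝ) (Set.Ioi 0), 0 < ε := eventually_mem_nhdsWithin
  exact (h2.and h1).exists

lemma aux_Y {d : ℕ} (Y : Set (Fin d → ℝ)) (hY : IsOpen Y) (α : Fin d → ℝ) (hα : α ∈ Y)
    (u : Fin d → ℝ) : ∀ᶠ ε in nhds (0 : ℝ), α + ε • u ∈ Y := by
  have : Continuous fun ε : ℝ => α + ε • u := by fun_prop
  exact this.continuousAt.eventually (hY.mem_nhds (by simpa using hα))

/-- Tangent-space description of the flux cone. -/
lemma aux_tangent {n m p d : ℕ} (Γ : Matrix (Fin n) (Fin m) ℤ) (blk : Fin m → Fin p)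
    (hfac : factorsOver Γ blk) (Y : Set (Fin d → ℝ)) (h : (Fin d → ℝ) → (Fin m → ℝ))
    (hadm : admissibleH Γ blk Y h) (α : Fin d → ℝ) (hα : α ∈ Y) :
    (∀ j, 0 < h α j) ∧ (mR Γ).mulVec (h α) = 0 ∧
    ∃ (L : (Fin d → ℝ) →ₗ[ℝ] (Fin m → ℝ)) (c : Fin m → ℝ), (∀ α, h α = L α + c) ∧
      (∀ u, (mR Γ).mulVec (L u) = 0) ∧
      (∀ (lam : Fin p → ℝ) (u : Fin d → ℝ), (∀ j, L u j = lam (blk j) * h α j) → u = 0 ∧ lam = 0) ∧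
      (∀ v : Fin m → ℝ, (mR Γ).mulVec v = 0 → ∃ (lam : Fin p → ℝ) (u : Fin d → ℝ),
        ∀ j, v j = lam (blk j) * h α j + L u j) := by
  obtain ⟨hYo, -, -, -, ⟨L, c, hL⟩, ⟨bY, hbY⟩, hin, hsurj, hinj⟩ := hadm
  have hone : ∀ β, fluxParam blk h (fun _ => 1) β = h β := by
    intro β; ext j; simp [fluxParam]
  have hker : ∀ β ∈ Y, (mR Γ).mulVec (h β) = 0 := by
    intro β hβ
    have := (hin (fun _ => 1) β (fun _ => one_pos) hβ).1
    rwa [hone] at this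
  have hpos : ∀ j, 0 < h α j := by
    have := (hin (fun _ => 1) α (fun _ => one_pos) hα).2
    rwa [hone] at this
  refine ⟨hpos, hker α hα, L, c, hL, ?_, ?_, ?_⟩
  · intro u
    obtain ⟨ε, hε, hεY⟩ := aux_pick (aux_Y Y hYo α hα u)
    have h1 := hker _ hεY
    have h2 : h (α + ε • u) = h α + ε • L u := by
      rw [hL, hL, map_add, map_smul]; abel
    rw [h2, Matrix.mulVec_add, hker α hα, zero_add, Matrix.mulVec_smul] at h1
    exact (smul_eq_zero.1 h1).resolve_left hε.ne'
  · intro lam u hlu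
    obtain ⟨ε, hε, hεY, hεl⟩ := aux_pick ((aux_Y Y hYo α hα u).and
      (aux_small (fun _ => 1) lam (fun _ => one_pos)))
    have := hinj (fun _ => 1) (fun i => 1 + ε * lam i) (α + ε • u) α (fun _ => one_pos)
      hεl hεY hα (by
        rw [hone]
        ext j
        rw [hL, map_add, map_smul]
        simp only [fluxParam, Pi.add_apply, Pi.smul_apply, smul_eq_mul]
        rw [hlu j]
        have : h α j = L α j + c j := by rw [hL]; rfl
        linear_combination (-1 : ℝ) * this)
    obtain ⟨t1, t2⟩ := this
    constructor
    · have : ε • u = 0 := by simpa using t2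
      exact (smul_eq_zero.1 this).resolve_left hε.ne'
    · ext i
      have := congrFun t1 i
      have : ε * lam i = 0 := by linarith
      simpa [hε.ne'] using this
  · intro v hv
    obtain ⟨ε, hε, hεp⟩ := aux_pick (aux_small (h α) v hpos)
    obtain ⟨lam, β, hlam, hβ, hE⟩ := hsurj (h α + ε • v)
      (by rw [Matrix.mulVec_add, hker α hα, Matrix.mulVec_smul, hv]; simp) hεp
    have hblock : ∀ (f : Fin p → ℝ) (u : Fin d → ℝ) (j : Fin m),
        L (fun t => f (bY t) * u t) j = f (blk j) * L u j := by
      intro f u j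
      have h1 := hbY (fun t => f (bY t) * u t) (f (blk j) • u) j
        (by intro t ht; simp [ht])
      rw [hL, hL, map_smul] at h1
      simpa using h1
    refine ⟨fun i => (lam i - 1) / ε, fun t => (lam (bY t) / ε) * (β - α) t, ?_⟩
    intro j
    rw [hblock (fun i => lam i / ε) (β - α) j]
    have h1 := congrFun hE j
    simp only [fluxParam, Pi.add_apply, Pi.smul_apply, smul_eq_mul] at h1
    have h2 : L (β - α) j = h β j - h α j := by
      rw [map_sub, hL, hL]; simp
    rw [h2]
    field_simp
    linear_combination h1

/-- Theorem `thminj`(iii): with `T_κ(α,μ) = h(α)^W − κ^W` and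
`F_κ(α,μ) = (h(α)/κ)^Ĝ ∘ μ^Q̂`, for `(α,μ) ∈ A_κ × ℝ^{n-s_P}_+` and `x := F_κ(α,μ)`,
the Jacobian `J_{F_κ}(α,μ)` maps `ker J_{T_κ}(α,μ)` isomorphically (bijectively)
onto `ker J_{g_κ}(x)`. -/
theorem statement1 {n m p d w q : ℕ}
    (Γ : Matrix (Fin n) (Fin m) ℤ) (A : Matrix (Fin m) (Fin n) ℤ)
    (hA : ∀ i j, 0 ≤ A i j)
    (blk : Fin m → Fin p) (hblk : Function.Surjective blk)
    (hdyn : dynNontrivial Γ) (hfac : factorsOver Γ blk)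
    (Y : Set (Fin d → ℝ)) (h : (Fin d → ℝ) → (Fin m → ℝ))
    (hd : m = d + (mR Γ).rank + p)
    (hadm : admissibleH Γ blk Y h)
    (W : Matrix (Fin w) (Fin m) ℝ) (hW : isSolvabilityMatrix A blk W)
    (Q : Matrix (Fin (n + p)) (Fin q) ℝ) (hQ : isKernelMatrix A blk Q)
    (G : Matrix (Fin (n + p)) (Fin m) ℝ) (hG : isGenInv A blk G)
    (κ : Fin m → ℝ) (hκ : κ ∈ posOrth m)
    (α : Fin d → ℝ) (μ : Fin q → ℝ)
    (hα : α ∈ Aset W Y h κ) (hμ : μ ∈ posOrth q) :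
    Set.BijOn (fun v => fderiv ℝ (Fmap G Q h κ) (α, μ) v)
      {v : (Fin d → ℝ) × (Fin q → ℝ) |
        fderiv ℝ (fun z : (Fin d → ℝ) × (Fin q → ℝ) =>
          powVec W (h z.1) - powVec W κ) (α, μ) v = 0}
      {z : Fin n → ℝ | (jacMat Γ A κ (Fmap G Q h κ (α, μ))).mulVec z = 0} := by
  obtain ⟨hαY, hαW⟩ := hα
  change ∀ i, 0 < κ i at hκ
  change ∀ i, 0 < μ i at hμ
  obtain ⟨hHpos, hHker, L, c, hL, hLker, hLinj, hLsurj⟩ :=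
    aux_tangent Γ blk hfac Y h hadm α hαY
  obtain ⟨hW0, hWr, hWm⟩ := hW
  obtain ⟨hQ0, hQr, hQm⟩ := hQ
  unfold isGenInv at hG
  set B := srcMat A blk with hB
  set H := h α with hH
  have exW : ∀ z, W.mulVec z = 0 → ∃ y, z = B.mulVec y :=
    aux_exact W B hW0 (by omega)
  have exQ : ∀ z, B.mulVec z = 0 → ∃ y, z = Q.mulVec y :=
    aux_exact B Q hQ0 (by omega)
  have hBG : ∀ y, B.mulVec (G.mulVec (B.mulVec y)) = B.mulVec y := by
    intro y; rw [Matrix.mulVec_mulVec, Matrix.mulVec_mulVec, hG]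
  have hBQ : ∀ s, B.mulVec (Q.mulVec s) = 0 := by
    intro s; rw [Matrix.mulVec_mulVec, hQ0, Matrix.zero_mulVec]
  have hrpos : ∀ j, 0 < (H / κ) j := fun j => div_pos (hHpos j) (hκ j)
  set x := Fmap G Q h κ (α, μ) with hx
  have hxdef : x = powVec (topRows n p G) (H / κ) * powVec (topRows n p Q) μ := rfl
  have hxpos : ∀ i, 0 < x i := fun i =>
    mul_pos (aux_powVec_pos _ _ hrpos i) (aux_powVec_pos _ _ hμ i)
  -- derivative of h
  have hhd : HasFDerivAt (fun z : (Fin d → ℝ) × (Fin q → ℝ) => h z.1)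
      ((LinearMap.toContinuousLinearMap L).comp
        (ContinuousLinearMap.fst ℝ (Fin d → ℝ) (Fin q → ℝ))) (α, μ) := by
    have e : (fun z : (Fin d → ℝ) × (Fin q → ℝ) => h z.1) =
        fun z => ((LinearMap.toContinuousLinearMap L).comp
        (ContinuousLinearMap.fst ℝ (Fin d → ℝ) (Fin q → ℝ))) z + c := by
      ext1 z; rw [hL]; rfl
    rw [e]
    exact (ContinuousLinearMap.hasFDerivAt _).add_const c
  -- derivative of T
  have hT : ∀ v : (Fin d → ℝ) × (Fin q → ℝ),
      fderiv ℝ (fun z : (Fin d → ℝ) × (Fin q → ℝ) =>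
          powVec W (h z.1) - powVec W κ) (α, μ) v = 0 ↔ W.mulVec (L v.1 / H) = 0 := by
    intro v
    obtain ⟨D, hD, hDv⟩ := aux_hasFDeriv W H hHpos
    have h1 := ((HasFDerivAt.comp (α, μ) (f := fun z : (Fin d → ℝ) × (Fin q → ℝ) => h z.1)
      hD hhd).sub_const (powVec W κ)).fderiv
    have h2 : fderiv ℝ (fun z : (Fin d → ℝ) × (Fin q → ℝ) =>
          powVec W (h z.1) - powVec W κ) (α, μ) v = powVec W H * W.mulVec (L v.1 / H) := by
      rw [← hDv]
      exact congrArg (fun f => f v) h1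
    rw [h2]
    constructor
    · intro h3
      ext i
      have := congrFun h3 i
      exact (mul_eq_zero.1 this).resolve_left (aux_powVec_pos W H hHpos i).ne'
    · intro h3; rw [h3, mul_zero]
  -- derivative of F
  have hF : ∀ v : (Fin d → ℝ) × (Fin q → ℝ), ∀ i,
      fderiv ℝ (Fmap G Q h κ) (α, μ) v i =
        x i * (G.mulVec (L v.1 / H) + Q.mulVec (v.2 / μ)) (Fin.castAdd p i) := by
    intro v i
    obtain ⟨D1, hD1, hDv1⟩ := aux_hasFDeriv (topRows n p G) (H / κ) hrpos
    obtain ⟨D2, hD2, hDv2⟩ := aux_hasFDeriv (topRows n p Q) μ hμ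
    have hdiv : HasFDerivAt (fun z : (Fin d → ℝ) × (Fin q → ℝ) => h z.1 / κ)
        ((ContinuousLinearMap.pi fun j => (κ j)⁻¹ • (ContinuousLinearMap.proj j :
          (Fin m → ℝ) →L[ℝ] ℝ)).comp ((LinearMap.toContinuousLinearMap L).comp
        (ContinuousLinearMap.fst ℝ (Fin d → ℝ) (Fin q → ℝ)))) (α, μ) := by
      have := HasFDerivAt.comp (α, μ) (f := fun z : (Fin d → ℝ) × (Fin q → ℝ) => h z.1)
        ((ContinuousLinearMap.pi fun j => (κ j)⁻¹ • (ContinuousLinearMap.proj j :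
          (Fin m → ℝ) →L[ℝ] ℝ)).hasFDerivAt) hhd
      refine this.congr_of_eventuallyEq (Filter.Eventually.of_forall fun z => ?_)
      ext j
      simp [div_eq_inv_mul]
    have g1 := HasFDerivAt.comp (α, μ)
      (f := fun z : (Fin d → ℝ) × (Fin q → ℝ) => h z.1 / κ) hD1 hdiv
    have g2 := HasFDerivAt.comp (α, μ) (f := fun z : (Fin d → ℝ) × (Fin q → ℝ) => z.2)
      hD2 hasFDerivAt_snd
    have g := (g1.mul g2).fderiv
    have g' := congrArg (fun f => f v i) g
    have e : fderiv ℝ (Fmap G Q h κ) (α, μ) v i =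
        powVec (topRows n p G) (H / κ) i * D2 v.2 i +
        D1 (fun j => (κ j)⁻¹ * L v.1 j) i * powVec (topRows n p Q) μ i := by
      refine Eq.trans g' ?_
      simp
      exact congrArg₂ (fun a b : ℝ => a + b) rfl (mul_comm (_ : ℝ) _)
    rw [e, hDv1, hDv2, hxdef]
    have e2 : (fun j => (κ j)⁻¹ * L v.1 j) / (H / κ) = L v.1 / H := by
      ext j
      have := (hκ j).ne'
      have := (hHpos j).ne'
      simp only [Pi.div_apply]
      field_simp
    rw [e2]
    have e3 : (topRows n p G).mulVec (L v.1 / H) i = G.mulVec (L v.1 / H) (Fin.castAdd p i) := rfl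
    have e4 : (topRows n p Q).mulVec (v.2 / μ) i = Q.mulVec (v.2 / μ) (Fin.castAdd p i) := rfl
    simp only [Pi.mul_apply, Pi.add_apply, e3, e4]
    ring
  -- the flux at x
  obtain ⟨ell, hellpos, hell⟩ : ∃ ell : Fin p → ℝ, (∀ i, 0 < ell i) ∧
      ∀ j, (κ * powVec (mR A) x) j = ell (blk j) * H j := by
    set y : Fin (n + p) → ℝ := G.mulVec (fun j => Real.log ((H / κ) j)) +
      Q.mulVec (fun j => Real.log (μ j)) with hy
    have hlx : ∀ i, Real.log (x i) = y (Fin.castAdd p i) := by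
      intro i
      have : x i = powVec (topRows n p G) (H / κ) i * powVec (topRows n p Q) μ i := rfl
      rw [this, Real.log_mul (aux_powVec_pos _ _ hrpos i).ne' (aux_powVec_pos _ _ hμ i).ne',
        aux_log_powVec _ _ hrpos, aux_log_powVec _ _ hμ]
      rfl
    have hWlog : W.mulVec (fun j => Real.log ((H / κ) j)) = 0 := by
      have e : (fun j => Real.log ((H / κ) j)) =
          (fun j => Real.log (H j)) - fun j => Real.log (κ j) := by
        ext j
        exact Real.log_div (hHpos j).ne' (hκ j).ne'
      rw [e, Matrix.mulVec_sub]
      ext i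
      rw [Pi.sub_apply, ← aux_log_powVec W H hHpos, ← aux_log_powVec W κ hκ, hαW]
      simp
    obtain ⟨η, hη⟩ := exW _ hWlog
    have hBy : B.mulVec y = fun j => Real.log ((H / κ) j) := by
      rw [hy, Matrix.mulVec_add, hBQ, hη, hBG, add_zero]
    refine ⟨fun i => Real.exp (- y (Fin.natAdd n i)), fun i => Real.exp_pos _, fun j => ?_⟩
    have h1 := congrFun hBy j
    rw [hB, aux_src] at h1
    have h2 : Real.log (powVec (mR A) x j) =
        (mR A).mulVec (fun i => y (Fin.castAdd p i)) j := by
      rw [aux_log_powVec _ _ hxpos]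
      congr 2
      ext i; exact hlx i
    rw [← h2, Pi.div_apply, Real.log_div (hHpos j).ne' (hκ j).ne'] at h1
    have hp := aux_powVec_pos (mR A) x hxpos j
    rw [Pi.mul_apply, ← Real.exp_log hp, ← Real.exp_log (hκ j), ← Real.exp_log (hHpos j),
      ← Real.exp_add, ← Real.exp_add]
    congr 1
    linarith
  -- kernel of the Jacobian
  have hJ : ∀ y : Fin n → ℝ, (jacMat Γ A κ x).mulVec (x * y) = 0 ↔
      (mR Γ).mulVec (H * (mR A).mulVec y) = 0 := by
    intro y
    have e : (jacMat Γ A κ x).mulVec (x * y) =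
        (mR Γ).mulVec (fun j => ell (blk j) * (H * (mR A).mulVec y) j) := by
      unfold jacMat
      rw [← Matrix.mulVec_mulVec, ← Matrix.mulVec_mulVec, ← Matrix.mulVec_mulVec]
      congr 1
      have e1 : (Matrix.diagonal fun i => (x i)⁻¹).mulVec (x * y) = y := by
        ext i
        rw [Matrix.mulVec_diagonal, Pi.mul_apply, inv_mul_cancel_left₀ (hxpos i).ne']
      rw [e1]
      ext j
      rw [Matrix.mulVec_diagonal, hell, Pi.mul_apply, mul_assoc]
    rw [e]
    constructor
    · intro h1
      have h2 := aux_scale Γ blk hfac _ h1 (fun i => (ell i)⁻¹)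
      convert h2 using 2
      ext j
      rw [inv_mul_cancel_left₀ (hellpos _).ne']
    · intro h1
      exact aux_scale Γ blk hfac _ h1 ell
  have hLH : ∀ u j, (L u / H) j * H j = L u j := fun u j =>
    div_mul_cancel₀ _ (hHpos j).ne'
  have hAy : ∀ (v : (Fin d → ℝ) × (Fin q → ℝ)), W.mulVec (L v.1 / H) = 0 → ∀ j,
      (mR A).mulVec (fun i =>
        (G.mulVec (L v.1 / H) + Q.mulVec (v.2 / μ)) (Fin.castAdd p i)) j +
      (G.mulVec (L v.1 / H) + Q.mulVec (v.2 / μ)) (Fin.natAdd n (blk j)) = (L v.1 / H) j := by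
    intro v hv j
    rw [← aux_src, ← hB]
    obtain ⟨η, hη⟩ := exW _ hv
    rw [Matrix.mulVec_add, hBQ, hη, hBG, add_zero]
  refine ⟨?_, ?_, ?_⟩
  · intro v hv
    have hv' := (hT v).1 hv
    change (jacMat Γ A κ x).mulVec _ = 0
    have e : fderiv ℝ (Fmap G Q h κ) (α, μ) v = x * fun i =>
        (G.mulVec (L v.1 / H) + Q.mulVec (v.2 / μ)) (Fin.castAdd p i) := by
      ext i; exact hF v i
    simp only [e]
    rw [hJ]
    set z := G.mulVec (L v.1 / H) + Q.mulVec (v.2 / μ) with hz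
    have e2 : H * (mR A).mulVec (fun i => z (Fin.castAdd p i)) =
        L v.1 - fun j => z (Fin.natAdd n (blk j)) * H j := by
      ext j
      have := hAy v hv' j
      have h3 := hLH v.1 j
      rw [← this] at h3
      simp only [Pi.mul_apply, Pi.sub_apply]
      linear_combination h3
    rw [e2, Matrix.mulVec_sub, hLker,
      aux_scale Γ blk hfac H hHker (fun i => z (Fin.natAdd n i)), sub_zero]
  · have key : ∀ v : (Fin d → ℝ) × (Fin q → ℝ), W.mulVec (L v.1 / H) = 0 →
        fderiv ℝ (Fmap G Q h κ) (α, μ) v = 0 → v = 0 := by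
      intro v hv h0
      have hA' := hAy v hv
      have htop : ∀ i, (G.mulVec (L v.1 / H) + Q.mulVec (v.2 / μ)) (Fin.castAdd p i) = 0 := by
        intro i
        have := hF v i
        rw [h0] at this
        exact (mul_eq_zero.1 this.symm).resolve_left (hxpos i).ne'
      obtain ⟨hu, hl⟩ := hLinj (fun i =>
        (G.mulVec (L v.1 / H) + Q.mulVec (v.2 / μ)) (Fin.natAdd n i)) v.1 (by
          intro j
          have h1 := hA' j
          simp only [htop] at h1
          have h2 : (mR A).mulVec (fun _ : Fin n => (0 : ℝ)) = 0 := Matrix.mulVec_zero _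
          rw [h2, Pi.zero_apply, zero_add] at h1
          rw [h1, hLH])
      have hu0 : L v.1 / H = 0 := by rw [hu, map_zero]; ext j; simp
      have hz : Q.mulVec (v.2 / μ) = 0 := by
        have : G.mulVec (L v.1 / H) + Q.mulVec (v.2 / μ) = 0 := by
          ext k
          refine Fin.addCases (fun i => htop i) (fun i => congrFun hl i) k
        rwa [hu0, Matrix.mulVec_zero, zero_add] at this
      have h3 := aux_inj Q hQr _ hz
      refine Prod.ext hu ?_
      ext k
      have := congrFun h3 k
      simpa [(hμ k).ne'] using this
    intro v hv v' hv' hvv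
    have h1 := (hT v).1 hv
    have h2 := (hT v').1 hv'
    have : v - v' = 0 := by
      have esub : (L v.1 - L v'.1) / H = L v.1 / H - L v'.1 / H := by
        ext j; exact sub_div _ _ _
      apply key
      · rw [Prod.fst_sub, map_sub, esub, Matrix.mulVec_sub, h1, h2, sub_zero]
      · rw [map_sub]; exact sub_eq_zero.2 hvv
    exact sub_eq_zero.1 this
  · intro z hz
    change (jacMat Γ A κ x).mulVec z = 0 at hz
    have hzx : z = x * (z / x) := by
      ext i
      simp only [Pi.mul_apply, Pi.div_apply]
      rw [mul_div_cancel₀ _ (hxpos i).ne']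
    rw [hzx, hJ] at hz
    obtain ⟨lam, u, hlu⟩ := hLsurj _ hz
    set y : Fin (n + p) → ℝ := Fin.append (z / x) (-lam) with hy
    have hBy : L u / H = B.mulVec y := by
      ext j
      rw [hB, aux_src]
      have e1 : (fun i => y (Fin.castAdd p i)) = z / x := by
        ext i; simp [hy]
      have e2 : y (Fin.natAdd n (blk j)) = - lam (blk j) := by simp [hy]
      rw [e1, e2, Pi.div_apply, div_eq_iff (hHpos j).ne']
      have := hlu j
      rw [Pi.mul_apply] at this
      linear_combination - this
    obtain ⟨s, hs⟩ := exQ (y - G.mulVec (L u / H)) (by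
      rw [Matrix.mulVec_sub, hBy, hBG, sub_self])
    refine ⟨(u, s * μ), (hT _).2 ?_, ?_⟩
    · change W.mulVec (L u / H) = 0
      rw [hBy, Matrix.mulVec_mulVec, hW0, Matrix.zero_mulVec]
    · ext i
      refine (hF _ i).trans ?_
      have e1 : s * μ / μ = s := by
        ext k
        simp only [Pi.mul_apply, Pi.div_apply]
        rw [mul_div_cancel_right₀ _ (hμ k).ne']
      simp only [e1]
      rw [← hs, add_sub_cancel]
      conv_rhs => rw [hzx]
      simp [hy]

end
end

section
/- Let a dynamically nontrivial mass action network with n species, m reactions and rank r factor over a p-partition P, and suppose n = s_P = r = m − p. Then the (n+p)×(n+p) matrix [A|1_P] is invertible, Y is a singleton {α}, and for every κ ∈ ℝ^m_+ the network has exactly one positive equilibrium, namely (h(α)/κ)^Ĝ where Ĝ consists of the first n rows of [A|1_P]^{-1}; moreover this unique equilibrium is nondegenerate. -/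
open Matrix

noncomputable section

lemma powVec_pos' {k l : ℕ} (M : Matrix (Fin k) (Fin l) ℝ) {x : Fin l → ℝ}
    (hx : ∀ i, 0 < x i) (i : Fin k) : 0 < powVec M x i :=
  Finset.prod_pos fun j _ => Real.rpow_pos_of_pos (hx j) _

lemma powVec_mul' {k l q : ℕ} (M : Matrix (Fin k) (Fin l) ℝ) (N : Matrix (Fin l) (Fin q) ℝ)
    {x : Fin q → ℝ} (hx : ∀ i, 0 < x i) : powVec M (powVec N x) = powVec (M * N) x := by
  funext i
  simp only [powVec, Matrix.mul_apply]
  have h1 : ∀ j, (∏ t, x t ^ N j t) ^ M i j = ∏ t, x t ^ (M i j * N j t) := by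
    intro j
    rw [← Real.finsetProd_rpow _ _ (fun t _ => (Real.rpow_pos_of_pos (hx t) _).le)]
    refine Finset.prod_congr rfl fun t _ => ?_
    rw [← Real.rpow_mul (hx t).le, mul_comm]
  simp only [h1]
  rw [Finset.prod_comm]
  refine Finset.prod_congr rfl fun t _ => ?_
  rw [Real.rpow_sum_of_pos (hx t)]

lemma powVec_one' {k : ℕ} (x : Fin k → ℝ) : powVec (1 : Matrix (Fin k) (Fin k) ℝ) x = x := by
  funext i
  simp only [powVec]
  rw [Finset.prod_eq_single i]
  · simp
  · intro j _ hj
    simp [Matrix.one_apply_ne hj.symm]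
  · simp

lemma powVec_src {n m p : ℕ} (A : Matrix (Fin m) (Fin n) ℤ) (blk : Fin m → Fin p)
    (x : Fin n → ℝ) (μ : Fin p → ℝ) (j : Fin m) :
    powVec (srcMat A blk) (Fin.append x μ) j = powVec (mR A) x j * μ (blk j) := by
  simp only [powVec, srcMat, mR, Fin.prod_univ_add, Matrix.of_apply, Fin.append_left,
    Fin.append_right, Matrix.map_apply]
  congr 1
  rw [Finset.prod_eq_single (blk j)]
  · simp
  · intro i _ hi
    simp [hi.symm]
  · simp

lemma src_mulVec {n m p : ℕ} (A : Matrix (Fin m) (Fin n) ℤ) (blk : Fin m → Fin p)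
    (x : Fin n → ℝ) (μ : Fin p → ℝ) (j : Fin m) :
    (srcMat A blk).mulVec (Fin.append x μ) j = (mR A).mulVec x j + μ (blk j) := by
  simp [Matrix.mulVec, dotProduct, srcMat, mR, Fin.sum_univ_add]

/-- Corollary, case `n = s_P = r = m − p`: the matrix `[A|1_P]`
is invertible, `Y` is a singleton `{α}`, and for each `κ ∈ ℝ^m_+` there is exactly
one positive equilibrium, namely `(h(α)/κ)^Ĝ` where `Ĝ` consists of the first `n`
rows of `[A|1_P]⁻¹`; moreover this unique equilibrium is nondegenerate. -/
theorem statement3 {n m p d : ℕ}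
    (Γ : Matrix (Fin n) (Fin m) ℤ) (A : Matrix (Fin m) (Fin n) ℤ)
    (hA : ∀ i j, 0 ≤ A i j)
    (blk : Fin m → Fin p) (hblk : Function.Surjective blk)
    (hdyn : dynNontrivial Γ) (hfac : factorsOver Γ blk)
    (Y : Set (Fin d → ℝ)) (h : (Fin d → ℝ) → (Fin m → ℝ))
    (hd : m = d + (mR Γ).rank + p)
    (hadm : admissibleH Γ blk Y h)
    (hrank : (mR Γ).rank = n)
    (hm : m = n + p)
    (hs : (srcMat A blk).rank = n + p) :
    ∃ B : Matrix (Fin (n + p)) (Fin m) ℝ,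
      srcMat A blk * B = 1 ∧ B * srcMat A blk = 1 ∧
      ∃ α : Fin d → ℝ, Y = {α} ∧
        ∀ κ ∈ posOrth m,
          Eset Γ A κ = {powVec (topRows n p B) (h α / κ)} ∧
          nondegAt Γ A κ (powVec (topRows n p B) (h α / κ)) := by
  subst hm
  have hd0 : d = 0 := by omega
  subst hd0
  have hU : IsUnit (srcMat A blk) := by
    rw [← Matrix.linearIndependent_rows_iff_isUnit, linearIndependent_iff_card_eq_finrank_span,
      Set.finrank, ← Matrix.rank_eq_finrank_span_row, hs, Fintype.card_fin]
  have hdet := (Matrix.isUnit_iff_isUnit_det _).1 hU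
  obtain ⟨B, hB1, hB2⟩ : ∃ B : Matrix (Fin (n + p)) (Fin (n + p)) ℝ,
      srcMat A blk * B = 1 ∧ B * srcMat A blk = 1 :=
    ⟨_, Matrix.mul_nonsing_inv _ hdet, Matrix.nonsing_inv_mul _ hdet⟩
  obtain ⟨-, -, -, ⟨α, hα⟩, -, -, hfwd, hsur, -⟩ := hadm
  refine ⟨B, hB1, hB2, α, ?_, ?_⟩
  · ext β
    rw [Subsingleton.elim β α]
    simp [hα]
  intro κ hκ
  have hκ' : ∀ i, 0 < κ i := hκ
  have hhα : ∀ j, 0 < h α j := by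
    intro j
    have := (hfwd (fun _ => 1) α (fun _ => one_pos) hα).2 j
    simpa [fluxParam] using this
  have hw : ∀ j, 0 < (h α / κ) j := fun j => div_pos (hhα j) (hκ' j)
  set w := h α / κ with hwdef
  set x := powVec (topRows n p B) w with hxdef
  have hx : ∀ i, 0 < x i := powVec_pos' _ hw
  set μ : Fin p → ℝ := fun i => powVec B w (Fin.natAdd n i) with hμdef
  have hμ : ∀ i, 0 < μ i := fun i => powVec_pos' B hw _
  have happ : powVec B w = Fin.append x μ := by
    funext i
    refine Fin.addCases (fun i => ?_) (fun i => ?_) i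
    · rw [Fin.append_left]; rfl
    · rw [Fin.append_right]
  have hkey : ∀ j, powVec (mR A) x j * μ (blk j) = w j := by
    intro j
    rw [← powVec_src, ← happ, powVec_mul' _ _ hw, hB1, powVec_one']
  have hflux : κ * powVec (mR A) x = fluxParam blk h (fun i => (μ i)⁻¹) α := by
    funext j
    have h1 := hkey j
    have h2 := (hμ (blk j)).ne'
    have h3 := (hκ' j).ne'
    simp only [hwdef, Pi.div_apply] at h1
    rw [eq_div_iff h3] at h1
    simp only [Pi.mul_apply, fluxParam]
    rw [← h1]
    field_simp
  have hker := hfwd (fun i => (μ i)⁻¹) α (fun i => inv_pos.2 (hμ i)) hα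
  rw [← hflux] at hker
  refine ⟨?_, ?_⟩
  · ext y
    simp only [Set.mem_singleton_iff]
    constructor
    · rintro ⟨hy, hy0⟩
      obtain ⟨lam, α', hlam, -, hv⟩ := hsur (κ * powVec (mR A) y) hy0
        (fun j => mul_pos (hκ' j) (powVec_pos' _ hy j))
      rw [Subsingleton.elim α' α] at hv
      have h1 : powVec (srcMat A blk) (Fin.append y fun i => (lam i)⁻¹) = w := by
        funext j
        rw [powVec_src]
        have h2 := congrFun hv j
        simp only [Pi.mul_apply, fluxParam] at h2
        have h3 := (hlam (blk j)).ne'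
        have h4 := (hκ' j).ne'
        simp only [hwdef, Pi.div_apply]
        field_simp
        linarith
      have hpos : ∀ i, 0 < (Fin.append y fun i => (lam i)⁻¹) i := by
        intro i
        refine Fin.addCases (fun i => ?_) (fun i => ?_) i
        · rw [Fin.append_left]; exact hy i
        · rw [Fin.append_right]; exact inv_pos.2 (hlam i)
      have h5 : powVec B w = Fin.append y fun i => (lam i)⁻¹ := by
        rw [← h1, powVec_mul' _ _ hpos, hB2, powVec_one']
      funext i
      have h6 := congrFun (h5.symm.trans happ) (Fin.castAdd p i)
      simpa using h6
    · rintro rfl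
      exact ⟨hx, hker.1⟩
  · intro z hz _
    set v := κ * powVec (mR A) x with hvdef
    set t := (mR A).mulVec (fun i => (x i)⁻¹ * z i) with htdef
    have hu : (mR Γ).mulVec (v * t) = 0 := by
      have : (jacMat Γ A κ x).mulVec z = (mR Γ).mulVec (v * t) := by
        simp only [jacMat, ← Matrix.mulVec_mulVec]
        congr 1
        have hz' : (Matrix.diagonal fun i => (x i)⁻¹).mulVec z = fun i => (x i)⁻¹ * z i := by
          funext i; rw [Matrix.mulVec_diagonal]
        rw [hz', ← htdef]
        funext j
        rw [Matrix.mulVec_diagonal]; rfl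
      rw [← this, hz]
    set ε : ℝ := (1 + ∑ j, |t j|)⁻¹ with hεdef
    have hS : 0 < 1 + ∑ j, |t j| := by positivity
    have hε : 0 < ε := inv_pos.2 hS
    have hε1 : ε * (1 + ∑ j, |t j|) = 1 := inv_mul_cancel₀ hS.ne'
    have ht : ∀ j, 0 < 1 + ε * t j := by
      intro j
      have h1 : |t j| ≤ ∑ j, |t j| :=
        Finset.single_le_sum (f := fun j => |t j|) (fun i _ => abs_nonneg _) (Finset.mem_univ j)
      have h2 := neg_abs_le (t j)
      have h3 : ε * (-∑ j, |t j|) ≤ ε * t j := by gcongr; linarith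
      linarith
    obtain ⟨lam, α', hlam, -, hv⟩ := hsur (v + ε • (v * t))
      (by rw [Matrix.mulVec_add, Matrix.mulVec_smul, hu, hker.1]; simp)
      (fun j => by
        have : (v + ε • (v * t)) j = v j * (1 + ε * t j) := by
          simp only [Pi.add_apply, Pi.smul_apply, Pi.mul_apply, smul_eq_mul]; ring
        rw [this]; exact mul_pos (hker.2 j) (ht j))
    rw [Subsingleton.elim α' α] at hv
    have htc : ∀ j, t j = (lam (blk j) * μ (blk j) - 1) / ε := by
      intro j
      have h1 := congrFun hv j
      have h2 := congrFun hflux j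
      simp only [Pi.add_apply, Pi.smul_apply, Pi.mul_apply, smul_eq_mul, fluxParam] at h1 h2
      have h3 := (hμ (blk j)).ne'
      have h5 : h α j = v j * μ (blk j) := by rw [h2]; field_simp
      rw [h5] at h1
      have h6 : v j * (1 + ε * t j) = v j * (lam (blk j) * μ (blk j)) := by linarith
      have h7 := mul_left_cancel₀ (hker.2 j).ne' h6
      rw [eq_div_iff hε.ne']
      linarith
    have h0 : (srcMat A blk).mulVec (Fin.append (fun i => (x i)⁻¹ * z i)
        (fun i => -((lam i * μ i - 1) / ε))) = 0 := by
      funext j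
      rw [src_mulVec, ← htdef, htc j]
      simp
    have h1 := congrArg B.mulVec h0
    rw [Matrix.mulVec_mulVec, hB2, Matrix.one_mulVec, Matrix.mulVec_zero] at h1
    funext i
    have h2 := congrFun h1 (Fin.castAdd p i)
    rw [Fin.append_left] at h2
    simpa [(hx i).ne'] using h2

end
end

section
/- Let a dynamically nontrivial (n,m,r) mass action network factor over a partition P and suppose s_P < r (the network is P-overdetermined). Then the set {κ ∈ ℝ^m_+ : E_κ ≠ ∅} of rate constants admitting a positive equilibrium has m-dimensional Lebesgue measure zero. -/
open Matrix

noncomputable section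

/-- Theorem `thmdegen`(i): for a `P`-overdetermined network
(`s_P < r`), the set of positive rate constants admitting a positive equilibrium
has `m`-dimensional Lebesgue measure zero. -/
theorem statement4 {n m p : ℕ}
    (Γ : Matrix (Fin n) (Fin m) ℤ) (A : Matrix (Fin m) (Fin n) ℤ)
    (hA : ∀ i j, 0 ≤ A i j)
    (blk : Fin m → Fin p) (hblk : Function.Surjective blk)
    (hdyn : dynNontrivial Γ) (hfac : factorsOver Γ blk)
    (hover : (srcMat A blk).rank < (mR Γ).rank + p) :
    MeasureTheory.volume {κ : Fin m → ℝ | (∀ j, 0 < κ j) ∧ (Eset Γ A κ).Nonempty} = 0 := by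
  classical
  let K : Submodule ℝ (Fin m → ℝ) := LinearMap.ker (mR Γ).mulVecLin
  let B : Submodule ℝ (Fin m → ℝ) := LinearMap.range (LinearMap.funLeft ℝ ℝ blk)
  let R : Submodule ℝ (Fin m → ℝ) := LinearMap.range (srcMat A blk).mulVecLin
  have hsrc : ∀ (u : Fin n → ℝ) (l : Fin p → ℝ) (j : Fin m),
      (srcMat A blk).mulVec (Fin.append u l) j = (∑ k, (A j k : ℝ) * u k) + l (blk j) := by
    intro u l j
    simp [Matrix.mulVec, dotProduct, srcMat, Fin.sum_univ_add]
  have hBR : B ≤ R := by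
    rintro _ ⟨l, rfl⟩
    refine ⟨Fin.append 0 l, ?_⟩
    ext j
    rw [Matrix.mulVecLin_apply, hsrc]
    simp [LinearMap.funLeft_apply]
  obtain ⟨T, hT⟩ := Submodule.exists_isCompl B
  let S : Submodule ℝ (Fin m → ℝ) := T ⊓ R
  have hSB : B ⊔ S = R := by
    have := sup_inf_assoc_of_le T hBR
    rw [hT.sup_eq_top, top_inf_eq] at this
    exact this.symm
  have hSB0 : B ⊓ S = ⊥ := by
    rw [eq_bot_iff, ← hT.inf_eq_bot]
    exact inf_le_inf_left _ inf_le_left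
  have hfB : Module.finrank ℝ B = p := by
    rw [LinearMap.finrank_range_of_inj (LinearMap.funLeft_injective_of_surjective ℝ ℝ blk hblk)]
    simp
  have hfR : Module.finrank ℝ R = (srcMat A blk).rank := rfl
  have hfK : (mR Γ).rank + Module.finrank ℝ K = m := by
    have := LinearMap.finrank_range_add_finrank_ker (mR Γ).mulVecLin
    rw [Module.finrank_fin_fun] at this
    exact this
  have hfS : Module.finrank ℝ R = p + Module.finrank ℝ S := by
    have := Submodule.finrank_sup_add_finrank_inf_eq B S
    rw [hSB, hSB0, finrank_bot, hfB] at this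
    omega
  let f : K × S → (Fin m → ℝ) := fun z j => (z.1 : Fin m → ℝ) j * Real.exp (-(z.2 : Fin m → ℝ) j)
  have hf : ContDiff ℝ 1 f := by
    rw [contDiff_pi]
    intro j
    have h1 : ContDiff ℝ 1 (fun z : K × S => (z.1 : Fin m → ℝ) j) :=
      ((ContinuousLinearMap.proj (R := ℝ) (φ := fun _ : Fin m => ℝ) j).comp
        (K.subtypeL.comp (ContinuousLinearMap.fst ℝ K S))).contDiff
    have h2 : ContDiff ℝ 1 (fun z : K × S => (z.2 : Fin m → ℝ) j) :=
      ((ContinuousLinearMap.proj (R := ℝ) (φ := fun _ : Fin m => ℝ) j).comp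
        (S.subtypeL.comp (ContinuousLinearMap.snd ℝ K S))).contDiff
    exact h1.mul h2.neg.exp
  have hdim : dimH (Set.range f) < ((m : NNReal) : ENNReal) := by
    refine lt_of_le_of_lt hf.dimH_range_le ?_
    rw [Module.finrank_prod]
    have : Module.finrank ℝ K + Module.finrank ℝ S < m := by omega
    exact_mod_cast this
  have hnull : MeasureTheory.volume (Set.range f) = 0 := by
    have := hausdorffMeasure_of_dimH_lt hdim
    rw [← MeasureTheory.hausdorffMeasure_pi_real]
    simpa using this
  refine MeasureTheory.measure_mono_null ?_ hnull
  rintro κ ⟨hκ, x, hx, hg⟩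
  have hpow : ∀ j, powVec (mR A) x j = Real.exp (∑ k, (A j k : ℝ) * Real.log (x k)) := by
    intro j
    rw [Real.exp_sum]
    refine Finset.prod_congr rfl fun k _ => ?_
    rw [Real.rpow_def_of_pos (hx k), mul_comm]
    rfl
  have hmem : (srcMat A blk).mulVec (Fin.append (fun k => Real.log (x k)) 0) ∈ B ⊔ S := by
    rw [hSB]
    exact ⟨_, rfl⟩
  obtain ⟨b, ⟨l, rfl⟩, w, hw, hbw⟩ := Submodule.mem_sup.1 hmem
  have hA' : ∀ j, ∑ k, (A j k : ℝ) * Real.log (x k) = l (blk j) + w j := by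
    intro j
    have := congrFun hbw j
    rw [hsrc] at this
    simpa [LinearMap.funLeft_apply] using this.symm
  have hv : (fun j => Real.exp (-l (blk j)) * (κ * powVec (mR A) x) j) ∈ K := by
    have hsum : (fun j => Real.exp (-l (blk j)) * (κ * powVec (mR A) x) j) =
        ∑ i : Fin p, Real.exp (-l i) •
          (fun j => if blk j = i then (κ * powVec (mR A) x) j else 0) := by
      ext j
      simp [Finset.sum_apply]
    rw [hsum]
    refine Submodule.sum_mem _ fun i _ => Submodule.smul_mem _ _ ?_
    exact hfac _ hg i
  refine ⟨(⟨_, hv⟩, ⟨w, hw⟩), ?_⟩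
  ext j
  simp only [f, Pi.mul_apply, hpow, hA']
  rw [mul_left_comm, mul_assoc, mul_assoc, ← Real.exp_add, ← Real.exp_add]
  simp

end
end

section
/- Let a dynamically nontrivial (n,m,r) mass action network factor over a partition P and suppose s_P < r (the network is P-overdetermined). Then the network is strongly degenerate: for every κ ∈ ℝ^m_+ and every positive equilibrium x ∈ E_κ, the Jacobian satisfies rank J_{g_κ}(x) < r. -/
open Matrix

noncomputable section

/-- Theorem `thmdegen`(iii): a `P`-overdetermined network
(`s_P < r`) is strongly degenerate: for every `κ ∈ ℝ^m_+` and every positive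
equilibrium `x ∈ E_κ`, `rank J_{g_κ}(x) < r`. -/
theorem statement5 {n m p : ℕ}
    (Γ : Matrix (Fin n) (Fin m) ℤ) (A : Matrix (Fin m) (Fin n) ℤ)
    (hA : ∀ i j, 0 ≤ A i j)
    (blk : Fin m → Fin p) (hblk : Function.Surjective blk)
    (hdyn : dynNontrivial Γ) (hfac : factorsOver Γ blk)
    (hover : (srcMat A blk).rank < (mR Γ).rank + p) :
    ∀ κ ∈ posOrth m, ∀ x ∈ Eset Γ A κ, (jacMat Γ A κ x).rank < (mR Γ).rank := by
  intro κ _ x hx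
  have hv : (mR Γ).mulVec (κ * powVec (mR A) x) = 0 := hx.2
  unfold jacMat
  generalize κ * powVec (mR A) x = v at hv
  set L : Matrix (Fin n) (Fin m) ℝ := mR Γ * Matrix.diagonal v with hL
  -- `L` kills every vector that is constant on blocks
  have hker : ∀ c : Fin p → ℝ, L.mulVec (fun j => c (blk j)) = 0 := by
    intro c
    have h1 : (Matrix.diagonal v).mulVec (fun j => c (blk j))
        = ∑ i, c i • (fun j => if blk j = i then v j else 0) := by
      ext j
      simp [Matrix.mulVec_diagonal, Finset.sum_apply, mul_comm]
    rw [hL, ← Matrix.mulVec_mulVec, h1, Matrix.mulVec_sum]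
    refine Finset.sum_eq_zero fun i _ => ?_
    rw [Matrix.mulVec_smul, hfac v hv i, smul_zero]
  have hsrc : ∀ (z : Fin n → ℝ) (c : Fin p → ℝ),
      (srcMat A blk).mulVec (Fin.append z c) = (mR A).mulVec z + fun j => c (blk j) := by
    intro z c
    ext j
    simp [Matrix.mulVec, dotProduct, srcMat, Fin.sum_univ_add, mR]
  set U := LinearMap.range (srcMat A blk).mulVecLin with hU
  have hrn := LinearMap.finrank_range_add_finrank_ker (L.mulVecLin.domRestrict U)
  have hUr : Module.finrank ℝ U = (srcMat A blk).rank := rfl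
  -- the kernel has dimension at least `p`
  have hp : p ≤ Module.finrank ℝ (LinearMap.ker (L.mulVecLin.domRestrict U)) := by
    have hmem : ∀ c : Fin p → ℝ, LinearMap.funLeft ℝ ℝ blk c ∈ U := by
      intro c
      refine ⟨Fin.append 0 c, ?_⟩
      rw [Matrix.mulVecLin_apply, hsrc]
      ext j
      simp [LinearMap.funLeft_apply]
    let f : (Fin p → ℝ) →ₗ[ℝ] U := (LinearMap.funLeft ℝ ℝ blk).codRestrict U hmem
    have hmem2 : ∀ c, f c ∈ LinearMap.ker (L.mulVecLin.domRestrict U) := by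
      intro c
      rw [LinearMap.mem_ker]
      exact hker c
    let g := f.codRestrict _ hmem2
    have hg : Function.Injective g := by
      intro a b hab
      have h2 : LinearMap.funLeft ℝ ℝ blk a = LinearMap.funLeft ℝ ℝ blk b :=
        congrArg Subtype.val (congrArg Subtype.val hab)
      exact LinearMap.funLeft_injective_of_surjective ℝ ℝ blk hblk h2
    simpa using LinearMap.finrank_le_finrank_of_injective hg
  -- the Jacobian range sits in `L(U)`
  have hle : (L * mR A).rank ≤ Module.finrank ℝ (LinearMap.range (L.mulVecLin.domRestrict U)) := by
    refine Submodule.finrank_mono ?_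
    rintro _ ⟨z, rfl⟩
    refine ⟨⟨(mR A).mulVec z, Fin.append z 0, ?_⟩, ?_⟩
    · rw [Matrix.mulVecLin_apply, hsrc]
      ext j
      simp
    · simp [LinearMap.domRestrict_apply, Matrix.mulVec_mulVec]
  have hJ := Matrix.rank_mul_le_left (L * mR A) (Matrix.diagonal (fun i => (x i)⁻¹))
  omega

end
end

section
/- Assume a dynamically nontrivial (n,m,r) mass action network factors over a p-partition P. Suppose that for some κ ∈ ℝ^m_+ and some j ∈ {1,…,p}, every positive equilibrium of the partition subnetwork N_j (with rate constants κ^{(j)}) is strongly degenerate, i.e. rank(Γ^{(j)} D_{κ^{(j)}∘x^{A^{(j)}}} A^{(j)} D_{1/x}) < r_j whenever Γ^{(j)}(κ^{(j)} ∘ x^{A^{(j)}}) = 0 with x ∈ ℝ^n_+. Then every x ∈ E_κ satisfies rank J_{g_κ}(x) < r. Consequently, if N_j is strongly degenerate, then so is the whole network. -/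
open Matrix

noncomputable section

/-- The submatrix `Γ^{(i)}` of `Γ` (columns outside block `i` zeroed out). -/
def maskCols {n m p : ℕ} (Γ : Matrix (Fin n) (Fin m) ℤ) (blk : Fin m → Fin p)
    (i : Fin p) : Matrix (Fin n) (Fin m) ℤ :=
  Matrix.of fun a b => if blk b = i then Γ a b else 0

theorem maskCols_mulVec {n m p : ℕ} (Γ : Matrix (Fin n) (Fin m) ℤ) (blk : Fin m → Fin p)
    (i : Fin p) (v : Fin m → ℝ) :
    (mR (maskCols Γ blk i)).mulVec v
      = (mR Γ).mulVec (fun k => if blk k = i then v k else 0) := by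
  funext a
  simp only [Matrix.mulVec, dotProduct, mR, maskCols, Matrix.map_apply, Matrix.of_apply]
  refine Finset.sum_congr rfl fun b _ => ?_
  split_ifs <;> simp

theorem jacMat_mulVec {n m : ℕ} (Γ : Matrix (Fin n) (Fin m) ℤ) (A : Matrix (Fin m) (Fin n) ℤ)
    (κ : Fin m → ℝ) (x : Fin n → ℝ) (z : Fin n → ℝ) :
    (jacMat Γ A κ x).mulVec z = (mR Γ).mulVec ((Matrix.diagonal (κ * powVec (mR A) x) *
      (mR A * Matrix.diagonal (fun i => (x i)⁻¹))).mulVec z) := by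
  simp only [jacMat, Matrix.mulVec_mulVec, Matrix.mul_assoc]

/-- Lemma on degenerate partition subnetworks: if, for some `κ`,
every positive equilibrium of the partition subnetwork `N_j` is strongly degenerate,
then every `x ∈ E_κ` satisfies `rank J_{g_κ}(x) < r`; consequently if `N_j` is
strongly degenerate then so is the whole network. -/
theorem statement7 {n m p : ℕ}
    (Γ : Matrix (Fin n) (Fin m) ℤ) (A : Matrix (Fin m) (Fin n) ℤ)
    (hA : ∀ i j, 0 ≤ A i j)
    (blk : Fin m → Fin p) (hblk : Function.Surjective blk)
    (hdyn : dynNontrivial Γ) (hfac : factorsOver Γ blk)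
    (j : Fin p) :
    ∀ κ ∈ posOrth m,
      (∀ x : Fin n → ℝ, (∀ i, 0 < x i) →
        (mR (maskCols Γ blk j)).mulVec (κ * powVec (mR A) x) = 0 →
        (jacMat (maskCols Γ blk j) A κ x).rank < (mR (maskCols Γ blk j)).rank) →
      ∀ x ∈ Eset Γ A κ, (jacMat Γ A κ x).rank < (mR Γ).rank := by
  intro κ _ hdeg x hx
  by_contra hcon
  push Not at hcon
  have heq : (mR (maskCols Γ blk j)).mulVec (κ * powVec (mR A) x) = 0 := by
    rw [maskCols_mulVec]
    exact hfac _ hx.2 j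
  have hlt := hdeg x hx.1 heq
  have hle : LinearMap.range (jacMat Γ A κ x).mulVecLin ≤ LinearMap.range (mR Γ).mulVecLin := by
    rintro _ ⟨z, rfl⟩
    exact ⟨_, (jacMat_mulVec Γ A κ x z).symm⟩
  have hrange := Submodule.eq_of_le_of_finrank_le hle hcon
  refine absurd hlt (not_lt.mpr (Submodule.finrank_mono ?_))
  rintro _ ⟨v, rfl⟩
  have hmem : (mR Γ).mulVec (fun k => if blk k = j then v k else 0)
      ∈ LinearMap.range (jacMat Γ A κ x).mulVecLin := by
    rw [hrange]
    exact ⟨_, rfl⟩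
  obtain ⟨z, hz⟩ := hmem
  rw [Matrix.mulVecLin_apply, jacMat_mulVec] at hz
  refine ⟨z, ?_⟩
  rw [Matrix.mulVecLin_apply, Matrix.mulVecLin_apply, jacMat_mulVec, ← sub_eq_zero,
    ← Matrix.mulVec_sub, maskCols_mulVec]
  have h0 := sub_eq_zero.mpr hz
  rw [← Matrix.mulVec_sub] at h0
  have h1 := hfac _ h0 j
  convert h1 using 2
  funext k
  by_cases hk : blk k = j <;> simp [hk]

end
end

section
/- Assume an (n,m,r) mass action network factors over a p-partition P. For each i let m_i := |P_i|, let ℓ_i be the number of distinct rows of A among those indexed by P_i, and let dim C_i denote the dimension of the linear span of the projection C_i of the positive flux cone C onto coordinates P_i. If dim C_i ≤ m_i − ℓ_i for some i, then E_κ = ∅ for all κ in a nonempty Zariski-open subset of ℝ^m_+, and the network is strongly degenerate. -/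
open Matrix

noncomputable section

/-- Abstract genericity lemma. -/
theorem aux_poly {B T : Type} [Fintype B] [Fintype T] (s : B → T) (b0 : B)
    (W : Submodule ℝ (B → ℝ))
    (h : Module.finrank ℝ W + Fintype.card T ≤ Fintype.card B) :
    ∃ F : MvPolynomial B ℝ, F ≠ 0 ∧ ∀ (κ : B → ℝ) (y : T → ℝ), (∀ t, y t ≠ 0) →
      (fun j => κ j * y (s j)) ∈ W → MvPolynomial.eval κ F = 0 := by
  classical
  let d := Module.finrank ℝ W
  let b : Module.Basis (Fin d) ℝ W := Module.finBasis ℝ W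
  let σ := Fin d ⊕ {t : T // t ≠ s b0}
  let q : B → MvPolynomial σ ℝ := fun j =>
    (∑ k, MvPolynomial.C ((b k : B → ℝ) j) * MvPolynomial.X (Sum.inl k)) *
      (if h : s j = s b0 then 1 else MvPolynomial.X (Sum.inr ⟨s j, h⟩))
  have hcard : Fintype.card σ < Fintype.card B := by
    have h1 : Fintype.card {t : T // t ≠ s b0} = Fintype.card T - 1 := by
      simp
    have h2 : 0 < Fintype.card T := Fintype.card_pos_iff.mpr ⟨s b0⟩
    simp only [σ, Fintype.card_sum, Fintype.card_fin, h1]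
    omega
  have hni : ¬ AlgebraicIndependent ℝ q := by
    intro hq
    have := hq.cardinalMk_le_trdeg
    rw [MvPolynomial.trdeg_of_isDomain] at this
    simp only [Cardinal.mk_fintype, Cardinal.lift_natCast, Nat.cast_le] at this
    omega
  rw [algebraicIndependent_iff] at hni
  push Not at hni
  obtain ⟨F, hF, hF0⟩ := hni
  refine ⟨F, hF0, ?_⟩
  intro κ y hy hW
  set w : W := ⟨_, hW⟩ with hw
  let c : σ → ℝ := Sum.elim (fun k => (y (s b0))⁻¹ * b.repr w k)
    (fun t => y (s b0) / y t.1)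
  have hsum : ∀ j, ∑ k, b.repr w k * (b k : B → ℝ) j = κ j * y (s j) := by
    intro j
    have h1 := b.sum_repr w
    have h2 : ((∑ k, b.repr w k • b k : W) : B → ℝ) j = κ j * y (s j) := by
      rw [h1]
    rw [← h2, Submodule.coe_sum, Finset.sum_apply]
    rfl
  have hev : ∀ j, MvPolynomial.eval c (q j) = κ j := by
    intro j
    have e1 : MvPolynomial.eval c (∑ k, MvPolynomial.C ((b k : B → ℝ) j) *
        MvPolynomial.X (Sum.inl k)) = (y (s b0))⁻¹ * (κ j * y (s j)) := by
      rw [← hsum j, Finset.mul_sum, map_sum]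
      refine Finset.sum_congr rfl fun k _ => ?_
      simp [c]; ring
    simp only [q, map_mul]
    rw [e1]
    have := hy (s b0)
    have := hy (s j)
    split_ifs with hs
    · rw [hs]; simp; field_simp
    · simp [c]; field_simp
  have h3 := congrArg (MvPolynomial.eval c) hF
  rw [map_zero, ← MvPolynomial.coe_aeval_eq_eval] at h3
  have h4 : (MvPolynomial.aeval c) ((MvPolynomial.aeval q) F) =
      MvPolynomial.aeval κ F := by
    rw [← AlgHom.comp_apply, MvPolynomial.comp_aeval]
    congr 2
    funext j
    simpa [MvPolynomial.coe_aeval_eq_eval] using hev j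
  rw [← MvPolynomial.coe_aeval_eq_eval]
  exact h4.symm.trans h3

/-- Abstract dimension count. -/
theorem aux_dim {B T : Type} [Fintype B] [Fintype T] (s : B → T)
    (W : Submodule ℝ (B → ℝ))
    (h : Module.finrank ℝ W + Fintype.card T ≤ Fintype.card B)
    (v : B → ℝ) (hv : v ∈ W) (hv0 : v ≠ 0)
    (hall : ∀ u : B → ℝ, ∃ y : T → ℝ, u - (fun j => v j * y (s j)) ∈ W) : False := by
  let L : (T → ℝ) →ₗ[ℝ] (B → ℝ) :=
    { toFun := fun y j => v j * y (s j)
      map_add' := by intro a b; funext j; simp [mul_add]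
      map_smul' := by intro a b; funext j; simp; ring }
  have htop : W ⊔ LinearMap.range L = ⊤ := by
    rw [eq_top_iff]
    intro u _
    obtain ⟨y, hy⟩ := hall u
    rw [Submodule.mem_sup]
    exact ⟨_, hy, L y, ⟨y, rfl⟩, by simp [L]⟩
  have h1 := Submodule.finrank_sup_add_finrank_inf_eq W (LinearMap.range L)
  have h2 : Module.finrank ℝ (LinearMap.range L) ≤ Fintype.card T := by
    simpa using LinearMap.finrank_range_le L
  have h3 : 0 < Module.finrank ℝ (W ⊓ LinearMap.range L : Submodule ℝ (B → ℝ)) := by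

    apply Nat.pos_of_ne_zero
    intro h0
    rw [Submodule.finrank_eq_zero] at h0
    have : v ∈ W ⊓ LinearMap.range L := ⟨hv, fun _ => 1, by funext j; simp [L]⟩
    rw [h0] at this
    exact hv0 (by simpa using this)
  rw [htop, finrank_top, Module.finrank_fintype_fun_eq_card] at h1
  omega

/-- Corollary `cor:linear_few`: if for some block `i` of the
partition, `dim C_i ≤ m_i − ℓ_i` (where `ℓ_i` is the number of distinct sources
among the reactions in `P_i` and `m_i = |P_i|`), then positive equilibria are
generically absent and the network is strongly degenerate. -/
theorem statement8 {n m p : ℕ}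
    (Γ : Matrix (Fin n) (Fin m) ℤ) (A : Matrix (Fin m) (Fin n) ℤ)
    (hA : ∀ i j, 0 ≤ A i j)
    (blk : Fin m → Fin p) (hblk : Function.Surjective blk)
    (hdyn : dynNontrivial Γ) (hfac : factorsOver Γ blk)
    (i : Fin p)
    (hcond :
      Module.finrank ℝ ↥(Submodule.span ℝ
          ((fun v : Fin m → ℝ => (fun j => if blk j = i then v j else 0 : Fin m → ℝ)) ''
            {v : Fin m → ℝ | (mR Γ).mulVec v = 0 ∧ ∀ j, 0 < v j})) +
        Set.ncard {s : Fin n → ℤ | ∃ k, blk k = i ∧ ∀ j, A k j = s j} ≤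
      (Finset.univ.filter fun k : Fin m => blk k = i).card) :
    (∃ F : MvPolynomial (Fin m) ℝ,
      (∃ κ ∈ posOrth m, MvPolynomial.eval κ F ≠ 0) ∧
      ∀ κ ∈ posOrth m, MvPolynomial.eval κ F ≠ 0 → Eset Γ A κ = ∅) ∧
    stronglyDegenerate Γ A := by
  classical
  have hTfin : {s : Fin n → ℤ | ∃ k, blk k = i ∧ ∀ j, A k j = s j}.Finite := by
    refine (Set.finite_range (fun k => A k)).subset ?_
    rintro s ⟨k, -, hk⟩
    exact ⟨k, funext hk⟩
  generalize hTdef : {s : Fin n → ℤ | ∃ k, blk k = i ∧ ∀ j, A k j = s j} = T at hcond hTfin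
  haveI : Fintype T := hTfin.fintype
  let B := {j : Fin m // blk j = i}
  let s : B → T := fun j => ⟨A j.1, by rw [← hTdef]; exact ⟨j.1, j.2, fun _ => rfl⟩⟩
  generalize hVdef : Submodule.span ℝ
          ((fun v : Fin m → ℝ => (fun j => if blk j = i then v j else 0 : Fin m → ℝ)) ''
            {v : Fin m → ℝ | (mR Γ).mulVec v = 0 ∧ ∀ j, 0 < v j}) = V at hcond
  let R : (Fin m → ℝ) →ₗ[ℝ] (B → ℝ) := LinearMap.funLeft ℝ ℝ Subtype.val
  have hR : ∀ v j, R v j = v j.1 := fun _ _ => rfl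
  let W := V.map R
  have hW : Module.finrank ℝ W + Fintype.card T ≤ Fintype.card B := by
    have h1 : Module.finrank ℝ W ≤ Module.finrank ℝ V := Submodule.finrank_map_le R V
    have h2 : T.ncard = Fintype.card T := by
      rw [Set.ncard_eq_toFinset_card', Set.toFinset_card]
    have h3 : Fintype.card B = (Finset.univ.filter fun k : Fin m => blk k = i).card :=
      Fintype.card_subtype _
    omega
  have hpos : ∀ v : Fin m → ℝ, (mR Γ).mulVec v = 0 → (∀ j, 0 < v j) → R v ∈ W := by
    intro v hv hv'
    refine ⟨fun j => if blk j = i then v j else 0, ?_, ?_⟩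
    · rw [← hVdef]
      exact Submodule.subset_span ⟨v, ⟨hv, hv'⟩, rfl⟩
    · funext j
      rw [hR, hR, if_pos j.2]
  have hker : ∀ u : Fin m → ℝ, (mR Γ).mulVec u = 0 → R u ∈ W := by
    intro u hu
    obtain ⟨v, hv, hv'⟩ := hdyn
    obtain ⟨t, ht0, ht⟩ : ∃ t : ℝ, 0 < t ∧ ∀ j, 0 < u j + t * v j := by
      refine ⟨1 + ∑ j, |u j| / v j, ?_, ?_⟩
      · have : 0 ≤ ∑ j, |u j| / v j :=
          Finset.sum_nonneg fun j _ => div_nonneg (abs_nonneg _) (hv' j).le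
        linarith
      · intro j
        have h1 : |u j| / v j ≤ ∑ j, |u j| / v j :=
          Finset.single_le_sum (f := fun j => |u j| / v j)
            (fun j _ => div_nonneg (abs_nonneg _) (hv' j).le) (Finset.mem_univ j)
        rw [div_le_iff₀ (hv' j)] at h1
        have h2 := neg_abs_le (u j)
        have h3 := hv' j
        nlinarith
    have h1 := hpos (u + t • v) (by rw [Matrix.mulVec_add, Matrix.mulVec_smul, hu, hv]; simp)
      (by intro j; simpa using ht j)
    have h2 := W.smul_mem t (hpos v hv hv')
    have h3 := W.sub_mem h1 h2
    simpa using h3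
  obtain ⟨k0, hk0⟩ := hblk i
  let b0 : B := ⟨k0, hk0⟩
  constructor
  · obtain ⟨F, hF0, hF⟩ := aux_poly s b0 W hW
    refine ⟨MvPolynomial.rename Subtype.val F, ?_, ?_⟩
    · by_contra! hcon
      apply hF0
      apply MvPolynomial.rename_injective _ (Subtype.val_injective (p := fun j => blk j = i))
      rw [map_zero]
      refine MvPolynomial.funext_set (fun _ => Set.Ioi (0 : ℝ)) (fun _ => Set.Ioi_infinite 0) ?_
      intro x hx
      rw [map_zero]
      exact hcon x fun j => hx j trivial
    · intro κ hκ hne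
      rw [Set.eq_empty_iff_forall_notMem]
      rintro x ⟨hx, hE⟩
      apply hne
      rw [MvPolynomial.eval_rename]
      refine hF _ (fun t => ∏ j, x j ^ ((t.1 j : ℤ) : ℝ)) (fun t => ?_) ?_
      · exact (Finset.prod_pos fun j _ => Real.rpow_pos_of_pos (hx j) _).ne'
      · exact hker (κ * powVec (mR A) x) hE
  · intro κ hκ x ⟨hx, hE⟩
    set v := κ * powVec (mR A) x with hvdef
    have hvpos : ∀ j, 0 < v j := fun j =>
      mul_pos (hκ j) (Finset.prod_pos fun j _ => Real.rpow_pos_of_pos (hx j) _)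
    by_contra hlt
    rw [not_lt] at hlt
    have hJ : jacMat Γ A κ x = mR Γ * (Matrix.diagonal v * mR A *
        Matrix.diagonal (fun i => (x i)⁻¹)) := by
      simp only [jacMat, Matrix.mul_assoc, hvdef]
    have hrange : LinearMap.range (mR Γ).mulVecLin ≤
        LinearMap.range (jacMat Γ A κ x).mulVecLin := by
      have hle : LinearMap.range (jacMat Γ A κ x).mulVecLin ≤
          LinearMap.range (mR Γ).mulVecLin := by
        rw [hJ, Matrix.mulVecLin_mul]
        exact LinearMap.range_comp_le_range _ _
      exact (Submodule.eq_of_le_of_finrank_le hle hlt).ge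
    refine aux_dim s W hW (R v) (hker v hE) ?_ ?_
    · intro h0
      have := congrFun h0 b0
      rw [hR] at this
      exact (hvpos _).ne' this
    · intro u
      let u' : Fin m → ℝ := fun j => if h : blk j = i then u ⟨j, h⟩ else 0
      obtain ⟨z, hz⟩ := hrange ⟨u', rfl⟩
      let z' : Fin n → ℝ := (Matrix.diagonal (fun i => (x i)⁻¹)).mulVec z
      refine ⟨fun t => ∑ k, ((t.1 k : ℤ) : ℝ) * z' k, ?_⟩
      have hk := hker (u' - (Matrix.diagonal v).mulVec ((mR A).mulVec z')) (by
        rw [Matrix.mulVec_sub, sub_eq_zero]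
        simp only [Matrix.mulVecLin_apply] at hz
        rw [← hz, hJ]
        simp only [z', Matrix.mulVec_mulVec, Matrix.mul_assoc])
      convert hk using 1
      funext j
      rw [hR]
      simp only [Pi.sub_apply, Matrix.mulVec_diagonal, hR]
      have : u' j.1 = u j := by simp only [u']; rw [dif_pos j.2]
      rw [this]
      rfl

end
end
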